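/- Every sentence of the countable-cofinality-quantifier logic L_{ω,ω}(Q^{cf}_{ℵ₀}) is equivalent (has exactly the same models, in every vocabulary) to a sentence of stationary logic L^{aa}_{ω,ω}; consequently h(L_{ω,ω}(Q^{cf}_{ℵ₀})) ≤ h(L^{aa}_{ω,ω}). -/

import Mathlib

open FirstOrder Cardinal

namespace Hanf

/-- Formulas of (extensions of) infinitary first-order logic over a vocabulary `L`:
first-order logic with equality, infinitary conjunctions, monadic second-order
(set) variables, binary relation variables, and the quantifiers
`wo` (well-ordering), `∃^c` (countable set), `aa` (stationary), `∃R` (second order),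
and `Q^{cf}_{ℵ₀}` (countable cofinality). -/
inductive Fml (L : FirstOrder.Language.{0,0}) : Type 1
  | rel : {n : ℕ} → L.Relations n → (Fin n → L.Term ℕ) → Fml L
  | eq : L.Term ℕ → L.Term ℕ → Fml L
  | mem : ℕ → L.Term ℕ → Fml L
  | rmem : ℕ → L.Term ℕ → L.Term ℕ → Fml L
  | not : Fml L → Fml L
  | conj : (ι : Type) → (ι → Fml L) → Fml L
  | all : ℕ → Fml L → Fml L
  | qWo : ℕ → ℕ → Fml L → Fml L
  | qC : ℕ → Fml L → Fml L
  | qAA : ℕ → Fml L → Fml L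
  | qII : ℕ → Fml L → Fml L
  | qCf : ℕ → ℕ → Fml L → Fml L

variable {L : FirstOrder.Language.{0,0}}

/-- A family of countable subsets of `M` which is closed under unions of countable
increasing chains and cofinal (under `⊆`) in the countable subsets of `M`. -/
def IsClubFam {M : Type} (C : Set (Set M)) : Prop :=
  (∀ S ∈ C, S.Countable) ∧
  (∀ f : ℕ → Set M, (∀ n, f n ∈ C) → Monotone f → (⋃ n, f n) ∈ C) ∧
  (∀ S : Set M, S.Countable → ∃ T ∈ C, S ⊆ T)

/-- The field of a binary relation. -/
def fieldOf {M : Type} (r : M → M → Prop) : Set M :=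
  {a | (∃ b, r a b) ∨ ∃ b, r b a}

/-- `r` well-orders its field. -/
def WellOrdersField {M : Type} (r : M → M → Prop) : Prop :=
  IsWellOrder (fieldOf r) (fun a b => r a.1 b.1)

/-- `r` is a linear order of its field, of cofinality `ℵ₀`:
it is irreflexive, transitive and trichotomous on its field, some countable
sequence is cofinal in it, and it has no maximal element. -/
def LinearOrdersFieldCofOmega {M : Type} (r : M → M → Prop) : Prop :=
  (∀ a ∈ fieldOf r, ¬ r a a) ∧
  (∀ a ∈ fieldOf r, ∀ b ∈ fieldOf r, ∀ c ∈ fieldOf r, r a b → r b c → r a c) ∧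
  (∀ a ∈ fieldOf r, ∀ b ∈ fieldOf r, a ≠ b → r a b ∨ r b a) ∧
  (∃ c : ℕ → M, (∀ n, c n ∈ fieldOf r) ∧ ∀ a ∈ fieldOf r, ∃ n, a = c n ∨ r a (c n)) ∧
  (∀ a ∈ fieldOf r, ∃ b ∈ fieldOf r, r a b)

/-- Satisfaction, relative to assignments of the first-order variables,
the monadic (set) variables and the binary relation variables. -/
def Eval {M : Type} [L.Structure M] :
    Fml L → (ℕ → M) → (ℕ → Set M) → (ℕ → M → M → Prop) → Prop
  | .rel R ts, va, _, _ => Language.Structure.RelMap R (fun i => (ts i).realize va)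
  | .eq t₁ t₂, va, _, _ => t₁.realize va = t₂.realize va
  | .mem X t, va, vs, _ => t.realize va ∈ vs X
  | .rmem R t₁ t₂, va, _, vr => vr R (t₁.realize va) (t₂.realize va)
  | .not φ, va, vs, vr => ¬ Eval φ va vs vr
  | .conj _ f, va, vs, vr => ∀ i, Eval (f i) va vs vr
  | .all x φ, va, vs, vr => ∀ a, Eval φ (Function.update va x a) vs vr
  | .qWo x y φ, va, vs, vr =>
      WellOrdersField (fun a b =>
        Eval φ (Function.update (Function.update va x a) y b) vs vr)
  | .qC X φ, va, vs, vr => ∃ S : Set M, S.Countable ∧ Eval φ va (Function.update vs X S) vr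
  | .qAA X φ, va, vs, vr =>
      ∃ C : Set (Set M), IsClubFam C ∧ ∀ S ∈ C, Eval φ va (Function.update vs X S) vr
  | .qII R φ, va, vs, vr => ∃ r : M → M → Prop, Eval φ va vs (Function.update vr R r)
  | .qCf x y φ, va, vs, vr =>
      LinearOrdersFieldCofOmega (fun a b =>
        Eval φ (Function.update (Function.update va x a) y b) vs vr)

/-- The variables of a term. -/
def tvars : L.Term ℕ → Set ℕ
  | .var i => {i}
  | .func _ ts => ⋃ i, tvars (ts i)

/-- Free first-order variables. -/
def fv : Fml L → Set ℕ
  | .rel _ ts => ⋃ i, tvars (ts i)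
  | .eq t₁ t₂ => tvars t₁ ∪ tvars t₂
  | .mem _ t => tvars t
  | .rmem _ t₁ t₂ => tvars t₁ ∪ tvars t₂
  | .not φ => fv φ
  | .conj _ f => ⋃ i, fv (f i)
  | .all x φ => fv φ \ {x}
  | .qWo x y φ => fv φ \ {x, y}
  | .qC _ φ => fv φ
  | .qAA _ φ => fv φ
  | .qII _ φ => fv φ
  | .qCf x y φ => fv φ \ {x, y}

/-- Free monadic (set) variables. -/
def sv : Fml L → Set ℕ
  | .rel _ _ => ∅
  | .eq _ _ => ∅
  | .mem X _ => {X}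
  | .rmem _ _ _ => ∅
  | .not φ => sv φ
  | .conj _ f => ⋃ i, sv (f i)
  | .all _ φ => sv φ
  | .qWo _ _ φ => sv φ
  | .qC X φ => sv φ \ {X}
  | .qAA X φ => sv φ \ {X}
  | .qII _ φ => sv φ
  | .qCf _ _ φ => sv φ

/-- Free binary relation variables. -/
def rv : Fml L → Set ℕ
  | .rel _ _ => ∅
  | .eq _ _ => ∅
  | .mem _ _ => ∅
  | .rmem R _ _ => {R}
  | .not φ => rv φ
  | .conj _ f => ⋃ i, rv (f i)
  | .all _ φ => rv φ
  | .qWo _ _ φ => rv φ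
  | .qC _ φ => rv φ
  | .qAA _ φ => rv φ
  | .qII R φ => rv φ \ {R}
  | .qCf _ _ φ => rv φ

/-- A sentence: no free variables of any kind. -/
def IsSentence (φ : Fml L) : Prop := fv φ = ∅ ∧ sv φ = ∅ ∧ rv φ = ∅

/-- Which extra quantifiers a logic allows, and the bound on the size
of its conjunctions (`conjBound = ℵ₀` gives finitary logic). -/
structure Allowed where
  wo : Prop
  c : Prop
  aa : Prop
  ii : Prop
  cf : Prop
  conjBound : Cardinal.{0}

/-- The formula lies in the logic described by `A`. -/
def Ok (A : Allowed) : Fml L → Prop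
  | .rel _ _ => True
  | .eq _ _ => True
  | .mem _ _ => True
  | .rmem _ _ _ => True
  | .not φ => Ok A φ
  | .conj ι f => #ι < A.conjBound ∧ ∀ i, Ok A (f i)
  | .all _ φ => Ok A φ
  | .qWo _ _ φ => A.wo ∧ Ok A φ
  | .qC _ φ => A.c ∧ Ok A φ
  | .qAA _ φ => A.aa ∧ Ok A φ
  | .qII _ φ => A.ii ∧ Ok A φ
  | .qCf _ _ φ => A.cf ∧ Ok A φ

/-- `M ⊨ φ` (for sentences this does not depend on the assignments). -/
def Sat (M : Type) [L.Structure M] (φ : Fml L) : Prop :=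
  ∀ (va : ℕ → M) (vs : ℕ → Set M) (vr : ℕ → M → M → Prop), Eval φ va vs vr

/-- `h(φ) < ∞`: `φ` has no models of arbitrarily large cardinality. -/
def BddSpec (φ : Fml L) : Prop :=
  ∃ κ : Cardinal, ∀ (M : Type) (S : L.Structure M), @Sat L M S φ → #M < κ

/-- The Hanf value `h(φ) = sup {|M|⁺ : M ⊨ φ}`. -/
noncomputable def hanfVal (φ : Fml L) : Cardinal :=
  sSup {c | ∃ (M : Type) (S : L.Structure M), @Sat L M S φ ∧ c = Order.succ #M}

/-- The Hanf number of the logic `A`: the supremum of `h(φ)` over all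
sentences `φ` of the logic (in any vocabulary) with `h(φ) < ∞`. -/
noncomputable def hanfNum (A : Allowed) : Cardinal :=
  sSup {c | ∃ (L : FirstOrder.Language.{0,0}) (φ : Fml L),
    IsSentence φ ∧ Ok A φ ∧ BddSpec φ ∧ c = hanfVal φ}

/-- The Hanf number of the logic `A` computed over vocabularies of cardinality `≤ χ`. -/
noncomputable def hanfNumVocab (A : Allowed) (χ : Cardinal) : Cardinal :=
  sSup {c | ∃ (L : FirstOrder.Language.{0,0}), L.card ≤ χ ∧ ∃ φ : Fml L,
    IsSentence φ ∧ Ok A φ ∧ BddSpec φ ∧ c = hanfVal φ}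

/-- `L^{wo}_{ω,ω}`. -/
def Lwo : Allowed := ⟨True, False, False, False, False, ℵ₀⟩
/-- `L^c_{ω,ω}`. -/
def Lc : Allowed := ⟨False, True, False, False, False, ℵ₀⟩
/-- `L^{aa}_{ω,ω}`. -/
def Laa : Allowed := ⟨False, False, True, False, False, ℵ₀⟩
/-- `L^{II}_{ω,ω}`. -/
def LII : Allowed := ⟨False, False, False, True, False, ℵ₀⟩
/-- `L_{ω,ω}(Q^{cf}_{ℵ₀})`. -/
def Lcf : Allowed := ⟨False, False, False, False, True, ℵ₀⟩
/-- `L^{wo}_{κ,ω}`: conjunctions of `< κ` formulas. -/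
def LwoInf (κ : Cardinal) : Allowed := ⟨True, False, False, False, False, κ⟩
/-- `L^c_{κ,ω}`. -/
def LcInf (κ : Cardinal) : Allowed := ⟨False, True, False, False, False, κ⟩
/-- `L^{II}_{κ,ω}`. -/
def LIIInf (κ : Cardinal) : Allowed := ⟨False, False, False, True, False, κ⟩


section Helpers

/-! ### Finitely many free variables, and independence of irrelevant assignments -/

theorem tvars_finite : ∀ t : L.Term ℕ, (tvars t).Finite
  | .var i => by simp [tvars]
  | .func _ ts => by
      simp only [tvars]
      exact Set.finite_iUnion fun i => tvars_finite (ts i)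

theorem realize_congr {M : Type} [L.Structure M] {va va' : ℕ → M} :
    ∀ t : L.Term ℕ, (∀ v ∈ tvars t, va v = va' v) → t.realize va = t.realize va'
  | .var i, h => h i (by simp [tvars])
  | .func f ts, h => by
      simp only [Language.Term.realize_func]
      congr 1
      funext i
      exact realize_congr (ts i) fun v hv => h v (by
        simp only [tvars, Set.mem_iUnion]; exact ⟨i, hv⟩)

theorem fv_finite (φ : Fml L) (h : Ok Lcf φ) : (fv φ).Finite := by
  induction φ with
  | rel R ts => exact Set.finite_iUnion fun i => tvars_finite (ts i)
  | eq t₁ t₂ => exact (tvars_finite t₁).union (tvars_finite t₂)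
  | mem X t => exact tvars_finite t
  | rmem R t₁ t₂ => exact (tvars_finite t₁).union (tvars_finite t₂)
  | not φ ih => exact ih h
  | conj ι f ih =>
      have : Finite ι := Cardinal.lt_aleph0_iff_finite.1 h.1
      exact Set.finite_iUnion fun i => ih i (h.2 i)
  | all x φ ih => exact (ih h).diff
  | qWo x y φ ih => exact h.1.elim
  | qC X φ ih => exact h.1.elim
  | qAA X φ ih => exact h.1.elim
  | qII R φ ih => exact h.1.elim
  | qCf x y φ ih => exact (ih h.2).diff

theorem eval_congr {M : Type} [L.Structure M] (φ : Fml L) (h : Ok Lcf φ) (hs : sv φ = ∅)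
    (va va' : ℕ → M) (vs vs' : ℕ → Set M) (vr : ℕ → M → M → Prop)
    (hv : ∀ v ∈ fv φ, va v = va' v) : Eval φ va vs vr ↔ Eval φ va' vs' vr := by
  induction φ generalizing va va' with
  | rel R ts =>
      simp only [Eval]
      have : (fun i => (ts i).realize va) = fun i => (ts i).realize va' := by
        funext i
        exact realize_congr _ fun v hv' => hv v (by
          simp only [fv, Set.mem_iUnion]; exact ⟨i, hv'⟩)
      rw [this]
  | eq t₁ t₂ =>
      simp only [Eval]
      rw [realize_congr t₁ fun v h => hv v (Or.inl h), realize_congr t₂ fun v h => hv v (Or.inr h)]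
  | mem X t => simp [sv] at hs
  | rmem R t₁ t₂ =>
      simp only [Eval]
      rw [realize_congr t₁ fun v h => hv v (Or.inl h), realize_congr t₂ fun v h => hv v (Or.inr h)]
  | not φ ih => simp only [Eval]; rw [ih h hs va va' hv]
  | conj ι f ih =>
      simp only [Eval]
      simp only [sv, Set.iUnion_eq_empty] at hs
      exact forall_congr' fun i => ih i (h.2 i) (hs i) va va' fun v hv' => hv v (by
        simp only [fv, Set.mem_iUnion]; exact ⟨i, hv'⟩)
  | all x φ ih =>
      simp only [Eval]
      refine forall_congr' fun a => ih h hs _ _ fun v hv' => ?_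
      by_cases hx : v = x
      · subst hx; simp
      · simp only [Function.update_of_ne hx]; exact hv v ⟨hv', hx⟩
  | qWo x y φ ih => exact h.1.elim
  | qC X φ ih => exact h.1.elim
  | qAA X φ ih => exact h.1.elim
  | qII R φ ih => exact h.1.elim
  | qCf x y φ ih =>
      simp only [Eval]
      have : (fun a b => Eval φ (Function.update (Function.update va x a) y b) vs vr) =
          (fun a b => Eval φ (Function.update (Function.update va' x a) y b) vs' vr) := by
        funext a b
        refine propext (ih h.2 hs _ _ fun v hv' => ?_)
        by_cases hy : v = y
        · subst hy; simp
        · by_cases hx : v = x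
          · subst hx; simp [Function.update_of_ne hy]
          · simp only [Function.update_of_ne hx, Function.update_of_ne hy]
            exact hv v ⟨hv', by simp [hx, hy]⟩
      rw [this]

/-! ### Connectives -/

def fand (φ ψ : Fml L) : Fml L := .conj Bool (fun b => cond b φ ψ)
def fimp (φ ψ : Fml L) : Fml L := .not (fand φ (.not ψ))
def fex (x : ℕ) (φ : Fml L) : Fml L := .not (.all x (.not φ))

/-- The formula `ψ(z, w)`, where `ψ = ψ(x, y)`. -/
def fsub (ψ : Fml L) (x y z w : ℕ) : Fml L :=
  .all x (fimp (.eq (.var x) (.var z)) (.all y (fimp (.eq (.var y) (.var w)) ψ)))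

section
variable {M : Type} [L.Structure M] (va : ℕ → M) (vs : ℕ → Set M) (vr : ℕ → M → M → Prop)

theorem eval_fand (φ ψ : Fml L) :
    Eval (fand φ ψ) va vs vr ↔ Eval φ va vs vr ∧ Eval ψ va vs vr := by
  simp only [fand, Eval, Bool.forall_bool, cond]; tauto

theorem eval_not (φ : Fml L) : Eval (.not φ) va vs vr ↔ ¬ Eval φ va vs vr := Iff.rfl

theorem eval_all (x : ℕ) (φ : Fml L) :
    Eval (.all x φ) va vs vr ↔ ∀ a, Eval φ (Function.update va x a) vs vr := Iff.rfl

theorem eval_fimp (φ ψ : Fml L) :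
    Eval (fimp φ ψ) va vs vr ↔ (Eval φ va vs vr → Eval ψ va vs vr) := by
  simp only [fimp, eval_not, eval_fand]; tauto

theorem eval_fex (x : ℕ) (φ : Fml L) :
    Eval (fex x φ) va vs vr ↔ ∃ a, Eval φ (Function.update va x a) vs vr := by
  simp only [fex, eval_not, eval_all]; push Not; rfl

theorem eval_fsub (ψ : Fml L) (x y z w : ℕ) (hzx : z ≠ x) (hwx : w ≠ x) (hwy : w ≠ y) :
    Eval (fsub ψ x y z w) va vs vr ↔
      Eval ψ (Function.update (Function.update va x (va z)) y (va w)) vs vr := by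
  simp only [fsub, eval_all, eval_fimp, Eval, Language.Term.realize_var, Function.update_self,
    Function.update_of_ne hzx, Function.update_of_ne hwx, Function.update_of_ne hwy, forall_eq]
end

theorem fv_fand (φ ψ : Fml L) : fv (fand φ ψ) = fv φ ∪ fv ψ := by
  ext v; simp [fand, fv, or_comm]
theorem sv_fand (φ ψ : Fml L) : sv (fand φ ψ) = sv φ ∪ sv ψ := by
  ext v; simp [fand, sv, or_comm]
theorem rv_fand (φ ψ : Fml L) : rv (fand φ ψ) = rv φ ∪ rv ψ := by
  ext v; simp [fand, rv, or_comm]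
theorem ok_fand (φ ψ : Fml L) : Ok Laa (fand φ ψ) ↔ Ok Laa φ ∧ Ok Laa ψ := by
  have : #Bool < ℵ₀ := Cardinal.lt_aleph0_of_finite _
  simp only [fand, Ok, Bool.forall_bool, Laa, this, true_and]; exact and_comm

/-- The translation of `qCf x y ψ`, using the fresh variables `p`, `q`, `s`. -/
def cfF (ψ : Fml L) (x y p q s : ℕ) : Fml L :=
  fand (.all p (.not (fsub ψ x y p p)))
  (fand (.all p (.all q (.all s (fimp (fsub ψ x y p q) (fimp (fsub ψ x y q s) (fsub ψ x y p s))))))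
  (fand (.all p (.all q (fimp (fex s (fsub ψ x y p s)) (fimp (fex s (fsub ψ x y q s))
    (fimp (.not (.eq (.var p) (.var q)))
      (fimp (.not (fsub ψ x y p q)) (fsub ψ x y q p)))))))
  (fand (.all p (.all q (fimp (fsub ψ x y q p) (fex s (fsub ψ x y p s)))))
  (fand (fex p (fex q (fsub ψ x y p q)))
    (.qAA 0 (.all p (fimp (fex s (fsub ψ x y p s))
      (fex s (fand (.mem 0 (.var s)) (fsub ψ x y p s))))))))))

theorem cf_iff {M : Type} (r : M → M → Prop) :
    LinearOrdersFieldCofOmega r ↔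
      (∀ a, ¬ r a a) ∧ (∀ a b c, r a b → r b c → r a c) ∧
      (∀ a b, (∃ c, r a c) → (∃ c, r b c) → ¬ a = b → ¬ r a b → r b a) ∧
      (∀ a b, r b a → ∃ c, r a c) ∧ (∃ a b, r a b) ∧
      ∃ C : Set (Set M), IsClubFam C ∧ ∀ S ∈ C, ∀ a, (∃ b, r a b) → ∃ b, b ∈ S ∧ r a b := by
  constructor
  · rintro ⟨h1, h2, h3, ⟨c, hc, hc'⟩, h5⟩
    have hm : ∀ a ∈ fieldOf r, ∃ b, r a b := fun a ha => (h5 a ha).imp fun _ h => h.2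
    refine ⟨fun a h => h1 a (Or.inl ⟨a, h⟩) h, fun a b d hab hbd =>
      h2 a (Or.inl ⟨b, hab⟩) b (Or.inl ⟨d, hbd⟩) d (Or.inr ⟨b, hbd⟩) hab hbd,
      fun a b ha hb hne hn => (h3 a (Or.inl ha) b (Or.inl hb) hne).resolve_left hn,
      fun a b hba => hm a (Or.inr ⟨b, hba⟩), ⟨c 0, hm _ (hc 0)⟩,
      {S | S.Countable ∧ Set.range c ⊆ S}, ⟨fun S hS => hS.1, fun f hf _ => ?_, fun S hS => ?_⟩,
      fun S hS a ⟨b, hab⟩ => ?_⟩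
    · exact ⟨Set.countable_iUnion fun n => (hf n).1, (hf 0).2.trans (Set.subset_iUnion f 0)⟩
    · exact ⟨S ∪ Set.range c, ⟨hS.union (Set.countable_range c), Set.subset_union_right⟩,
        Set.subset_union_left⟩
    · have hb : b ∈ fieldOf r := Or.inr ⟨a, hab⟩
      obtain ⟨n, rfl | hn⟩ := hc' b hb
      · exact ⟨_, hS.2 ⟨n, rfl⟩, hab⟩
      · exact ⟨_, hS.2 ⟨n, rfl⟩, h2 a (Or.inl ⟨b, hab⟩) b hb _ (hc n) hab hn⟩
  · rintro ⟨h1, h2, h3, h4, ⟨a₀, b₀, h0⟩, C, hC, hC'⟩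
    have hm : ∀ a ∈ fieldOf r, ∃ b, r a b := by
      rintro a (h | ⟨b, h⟩)
      · exact h
      · exact h4 a b h
    obtain ⟨T, hT, -⟩ := hC.2.2 ∅ Set.countable_empty
    refine ⟨fun a _ => h1 a, fun a _ b _ c _ => h2 a b c, fun a ha b hb hne => ?_, ?_,
      fun a ha => ?_⟩
    · by_contra! hcon
      exact hcon.2 (h3 a b (hm a ha) (hm b hb) hne hcon.1)
    · have hne : (T ∩ fieldOf r).Nonempty := by
        obtain ⟨b, hb, hab⟩ := hC' T hT a₀ ⟨b₀, h0⟩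
        exact ⟨b, hb, Or.inr ⟨a₀, hab⟩⟩
      obtain ⟨c, hc⟩ := ((hC.1 T hT).mono Set.inter_subset_left).exists_eq_range hne
      refine ⟨c, fun n => (hc ▸ Set.mem_range_self n : c n ∈ T ∩ fieldOf r).2, fun a ha => ?_⟩
      obtain ⟨b, hb, hab⟩ := hC' T hT a (hm a ha)
      have : b ∈ Set.range c := hc ▸ ⟨hb, Or.inr ⟨a, hab⟩⟩
      obtain ⟨n, rfl⟩ := this
      exact ⟨n, Or.inr hab⟩
    · obtain ⟨b, hb⟩ := hm a ha
      exact ⟨b, Or.inr ⟨a, hb⟩, hb⟩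

theorem eval_cfF {M : Type} [L.Structure M] (φ ψ : Fml L) (h : Ok Lcf φ) (hs : sv φ = ∅)
    (hψ : ∀ (va : ℕ → M) vs vr, Eval φ va vs vr ↔ Eval ψ va vs vr) (x y p q s : ℕ)
    (hp : p ∉ fv φ ∪ {x, y}) (hq : q ∉ fv φ ∪ {x, y}) (hs' : s ∉ fv φ ∪ {x, y})
    (hpq : p ≠ q) (hps : p ≠ s) (hqs : q ≠ s)
    (va : ℕ → M) (vs : ℕ → Set M) (vr : ℕ → M → M → Prop) :
    Eval (.qCf x y φ) va vs vr ↔ Eval (cfF ψ x y p q s) va vs vr := by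
  have key : ∀ z w, z ∉ fv φ ∪ {x, y} → w ∉ fv φ ∪ {x, y} → ∀ (va' : ℕ → M) vs',
      (∀ v ∈ fv φ, va' v = va v) → (Eval (fsub ψ x y z w) va' vs' vr ↔
        Eval φ (Function.update (Function.update va x (va' z)) y (va' w)) vs vr) := by
    intro z w hz hw va' vs' hv
    simp only [Set.mem_union, Set.mem_insert_iff, Set.mem_singleton_iff, not_or] at hz hw
    rw [eval_fsub _ _ _ _ _ _ _ _ hz.2.1 hw.2.1 hw.2.2, ← hψ]
    refine eval_congr φ h hs _ _ _ _ _ fun v hv' => ?_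
    by_cases hy : v = y
    · subst hy; simp
    · by_cases hx : v = x
      · subst hx; simp [Function.update_of_ne hy]
      · simp only [Function.update_of_ne hx, Function.update_of_ne hy]
        exact hv v hv'
  have up : ∀ z, z ∉ fv φ ∪ {x, y} → ∀ (va' : ℕ → M) a, (∀ v ∈ fv φ, va' v = va v) →
      (∀ v ∈ fv φ, Function.update va' z a v = va v) := by
    intro z hz va' a hv v hv'
    rw [Function.update_of_ne, hv v hv']
    rintro rfl
    exact hz (Or.inl hv')
  have h0 : ∀ v ∈ fv φ, va v = va v := fun _ _ => rfl
  have e1 : Eval (.qCf x y φ) va vs vr ↔ LinearOrdersFieldCofOmega (fun a b =>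
        Eval φ (Function.update (Function.update va x a) y b) vs vr) := Iff.rfl
  rw [e1, cf_iff]
  have hm : ∀ (va' : ℕ → M) (S : Set M), Eval (L := L) (.mem 0 (.var s)) va'
      (Function.update vs 0 S) vr ↔ va' s ∈ S := by
    intro va' S
    simp [Eval]
  have hqa : ∀ χ : Fml L, Eval (.qAA 0 χ) va vs vr ↔ ∃ C : Set (Set M), IsClubFam C ∧
      ∀ S ∈ C, Eval χ va (Function.update vs 0 S) vr := fun χ => Iff.rfl
  have he : ∀ (va' : ℕ → M), Eval (L := L) (.eq (.var p) (.var q)) va' vs vr ↔ va' p = va' q :=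
    fun va' => Iff.rfl
  have kp := up p hp
  have kq := up q hq
  have ks := up s hs'
  simp only [cfF, eval_fand, eval_not, eval_all, eval_fimp, eval_fex, hqa, he, hm]
  simp (discharger := first | assumption | (repeat' first | exact h0 | apply kp | apply kq | apply ks))
    only [key, Function.update_self, Function.update_of_ne hpq, Function.update_of_ne hps,
      Function.update_of_ne hqs, Function.update_of_ne hpq.symm, Function.update_of_ne hps.symm,
      Function.update_of_ne hqs.symm]

theorem exists_trans (φ : Fml L) (h : Ok Lcf φ) (hs : sv φ = ∅) :
    ∃ ψ : Fml L, fv ψ ⊆ fv φ ∧ sv ψ = ∅ ∧ rv ψ ⊆ rv φ ∧ Ok Laa ψ ∧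
      ∀ (M : Type) (_ : L.Structure M) (va : ℕ → M) (vs : ℕ → Set M) (vr : ℕ → M → M → Prop),
        Eval φ va vs vr ↔ Eval ψ va vs vr := by
  induction φ with
  | rel R ts => exact ⟨.rel R ts, subset_rfl, hs, subset_rfl, trivial, fun _ _ _ _ _ => Iff.rfl⟩
  | eq t₁ t₂ => exact ⟨.eq t₁ t₂, subset_rfl, hs, subset_rfl, trivial, fun _ _ _ _ _ => Iff.rfl⟩
  | mem X t => exact ⟨.mem X t, subset_rfl, hs, subset_rfl, trivial, fun _ _ _ _ _ => Iff.rfl⟩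
  | rmem R t₁ t₂ =>
      exact ⟨.rmem R t₁ t₂, subset_rfl, hs, subset_rfl, trivial, fun _ _ _ _ _ => Iff.rfl⟩
  | not φ ih =>
      obtain ⟨ψ, h1, h2, h3, h4, h5⟩ := ih h hs
      exact ⟨.not ψ, h1, h2, h3, h4, fun M S va vs vr => not_congr (h5 M S va vs vr)⟩
  | conj ι f ih =>
      simp only [sv, Set.iUnion_eq_empty] at hs
      choose g h1 h2 h3 h4 h5 using fun i => ih i (h.2 i) (hs i)
      exact ⟨.conj ι g, Set.iUnion_mono h1, Set.iUnion_eq_empty.2 h2, Set.iUnion_mono h3,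
        ⟨h.1, h4⟩, fun M S va vs vr => forall_congr' fun i => h5 i M S va vs vr⟩
  | all x φ ih =>
      obtain ⟨ψ, h1, h2, h3, h4, h5⟩ := ih h hs
      exact ⟨.all x ψ, Set.diff_subset_diff_left h1, h2, h3, h4,
        fun M S va vs vr => forall_congr' fun a => h5 M S _ vs vr⟩
  | qWo x y φ ih => exact h.1.elim
  | qC X φ ih => exact h.1.elim
  | qAA X φ ih => exact h.1.elim
  | qII R φ ih => exact h.1.elim
  | qCf x y φ ih =>
      obtain ⟨ψ, h1, h2, h3, h4, h5⟩ := ih h.2 hs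
      have hfin : (fv φ ∪ {x, y}).Finite := (fv_finite φ h.2).union (by simp)
      obtain ⟨p, hp⟩ := hfin.infinite_compl.nonempty
      obtain ⟨q, hq⟩ := (hfin.union (Set.finite_singleton p)).infinite_compl.nonempty
      obtain ⟨s, hs'⟩ := (hfin.union (Set.toFinite {p, q})).infinite_compl.nonempty
      rw [Set.mem_compl_iff, Set.mem_union, not_or] at hq hs'
      have hpq : p ≠ q := fun e => hq.2 e.symm
      have hps : p ≠ s := fun e => hs'.2 (by simp [e])
      have hqs : q ≠ s := fun e => hs'.2 (by simp [e])
      refine ⟨cfF ψ x y p q s, ?_, ?_, ?_, ?_, fun M S va vs vr =>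
        eval_cfF φ ψ h.2 hs (h5 M S) x y p q s hp hq.1 hs'.1 hpq hps hqs va vs vr⟩
      · intro v
        have h1v := @h1 v
        simp only [cfF, fsub, fimp, fex, fv_fand, fv, tvars, Set.mem_union, Set.mem_diff,
          Set.mem_singleton_iff, Set.mem_insert_iff]
        grind
      · simp [cfF, fsub, fimp, fex, sv_fand, sv, h2]
      · intro v
        have h3v := @h3 v
        simp only [cfF, fsub, fimp, fex, rv_fand, rv, Set.mem_union, Set.mem_empty_iff_false]
        grind
      · simp [cfF, fsub, fimp, fex, ok_fand, Ok, h4]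
        trivial

/-! ### The Hanf number of a finitary logic is a genuine supremum -/

/-- A universal countable vocabulary. -/
def Lu : FirstOrder.Language.{0,0} := ⟨fun _ => ℕ, fun _ => ℕ⟩

/-- Codes for finitary formulas over `Lu`, forming a small type. -/
inductive Code : Type
  | rel : (n : ℕ) → ℕ → (Fin n → Lu.Term ℕ) → Code
  | eq : Lu.Term ℕ → Lu.Term ℕ → Code
  | mem : ℕ → Lu.Term ℕ → Code
  | rmem : ℕ → Lu.Term ℕ → Lu.Term ℕ → Code
  | not : Code → Code
  | conj : (n : ℕ) → (Fin n → Code) → Code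
  | all : ℕ → Code → Code
  | qWo : ℕ → ℕ → Code → Code
  | qC : ℕ → Code → Code
  | qAA : ℕ → Code → Code
  | qII : ℕ → Code → Code
  | qCf : ℕ → ℕ → Code → Code

def Code.toFml : Code → Fml Lu
  | .rel n k ts => .rel (n := n) (L := Lu) (show Lu.Relations n from k) ts
  | .eq t₁ t₂ => .eq t₁ t₂
  | .mem X t => .mem X t
  | .rmem R t₁ t₂ => .rmem R t₁ t₂
  | .not φ => .not φ.toFml
  | .conj n f => .conj (Fin n) (fun i => (f i).toFml)
  | .all x φ => .all x φ.toFml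
  | .qWo x y φ => .qWo x y φ.toFml
  | .qC X φ => .qC X φ.toFml
  | .qAA X φ => .qAA X φ.toFml
  | .qII R φ => .qII R φ.toFml
  | .qCf x y φ => .qCf x y φ.toFml

/-- Function symbols used in a term. -/
def tF : L.Term ℕ → Set (Σ n, L.Functions n)
  | .var _ => ∅
  | .func f ts => {⟨_, f⟩} ∪ ⋃ i, tF (ts i)

/-- Function symbols used in a formula. -/
def uF : Fml L → Set (Σ n, L.Functions n)
  | .rel _ ts => ⋃ i, tF (ts i)
  | .eq t₁ t₂ => tF t₁ ∪ tF t₂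
  | .mem _ t => tF t
  | .rmem _ t₁ t₂ => tF t₁ ∪ tF t₂
  | .not φ => uF φ
  | .conj _ f => ⋃ i, uF (f i)
  | .all _ φ => uF φ
  | .qWo _ _ φ => uF φ
  | .qC _ φ => uF φ
  | .qAA _ φ => uF φ
  | .qII _ φ => uF φ
  | .qCf _ _ φ => uF φ

/-- Relation symbols used in a formula. -/
def uR : Fml L → Set (Σ n, L.Relations n)
  | .rel R _ => {⟨_, R⟩}
  | .eq _ _ => ∅
  | .mem _ _ => ∅
  | .rmem _ _ _ => ∅
  | .not φ => uR φ
  | .conj _ f => ⋃ i, uR (f i)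
  | .all _ φ => uR φ
  | .qWo _ _ φ => uR φ
  | .qC _ φ => uR φ
  | .qAA _ φ => uR φ
  | .qII _ φ => uR φ
  | .qCf _ _ φ => uR φ

theorem tF_countable : ∀ t : L.Term ℕ, (tF t).Countable
  | .var _ => Set.countable_empty
  | .func f ts => (Set.countable_singleton _).union
      (Set.countable_iUnion fun i => tF_countable (ts i))

theorem uF_countable (A : Allowed) (hA : A.conjBound = ℵ₀) (φ : Fml L) (h : Ok A φ) :
    (uF φ).Countable := by
  induction φ with
  | rel R ts => exact Set.countable_iUnion fun i => tF_countable (ts i)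
  | eq t₁ t₂ => exact (tF_countable t₁).union (tF_countable t₂)
  | mem X t => exact tF_countable t
  | rmem R t₁ t₂ => exact (tF_countable t₁).union (tF_countable t₂)
  | not φ ih => exact ih h
  | conj ι f ih =>
      have : Finite ι := Cardinal.lt_aleph0_iff_finite.1 (hA ▸ h.1)
      exact Set.countable_iUnion fun i => ih i (h.2 i)
  | all x φ ih => exact ih h
  | qWo x y φ ih => exact ih h.2
  | qC X φ ih => exact ih h.2
  | qAA X φ ih => exact ih h.2
  | qII R φ ih => exact ih h.2
  | qCf x y φ ih => exact ih h.2

theorem uR_countable (A : Allowed) (hA : A.conjBound = ℵ₀) (φ : Fml L) (h : Ok A φ) :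
    (uR φ).Countable := by
  induction φ with
  | rel R ts => exact Set.countable_singleton _
  | eq t₁ t₂ => exact Set.countable_empty
  | mem X t => exact Set.countable_empty
  | rmem R t₁ t₂ => exact Set.countable_empty
  | not φ ih => exact ih h
  | conj ι f ih =>
      have : Finite ι := Cardinal.lt_aleph0_iff_finite.1 (hA ▸ h.1)
      exact Set.countable_iUnion fun i => ih i (h.2 i)
  | all x φ ih => exact ih h
  | qWo x y φ ih => exact ih h.2
  | qC X φ ih => exact ih h.2
  | qAA X φ ih => exact ih h.2
  | qII R φ ih => exact ih h.2
  | qCf x y φ ih => exact ih h.2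

/-- `S` and `S'` agree on the symbols in `U`, `V`, along the codings `e`, `r`. -/
def Agree (e : (Σ n, L.Functions n) → ℕ) (r : (Σ n, L.Relations n) → ℕ)
    (U : Set (Σ n, L.Functions n)) (V : Set (Σ n, L.Relations n)) (M : Type)
    (S : L.Structure M) (S' : Lu.Structure M) : Prop :=
  (∀ n (f : L.Functions n), ⟨n, f⟩ ∈ U → ∀ x : Fin n → M,
    S.funMap f x = S'.funMap (show Lu.Functions n from e ⟨n, f⟩) x) ∧
  (∀ n (f : L.Relations n), ⟨n, f⟩ ∈ V → ∀ x : Fin n → M,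
    S.RelMap f x ↔ S'.RelMap (show Lu.Relations n from r ⟨n, f⟩) x)

def trT (e : (Σ n, L.Functions n) → ℕ) : L.Term ℕ → Lu.Term ℕ
  | .var i => .var i
  | .func (l := n) f ts => .func (show Lu.Functions n from e ⟨n, f⟩) (fun i => trT e (ts i))

theorem realize_trT (e : (Σ n, L.Functions n) → ℕ) (r : (Σ n, L.Relations n) → ℕ)
    (U : Set (Σ n, L.Functions n)) (V : Set (Σ n, L.Relations n)) (M : Type)
    (S : L.Structure M) (S' : Lu.Structure M) (hA : Agree e r U V M S S') (va : ℕ → M) :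
    ∀ t : L.Term ℕ, tF t ⊆ U → t.realize va = (trT e t).realize va
  | .var i, _ => rfl
  | .func (l := n) f ts, h => by
      simp only [trT, Language.Term.realize_func]
      have h1 : (fun i => (ts i).realize va) = fun i => (trT e (ts i)).realize va := by
        funext i
        refine realize_trT e r U V M S S' hA va (ts i) fun z hz => h ?_
        simp only [tF]
        exact Or.inr (Set.mem_iUnion.2 ⟨i, hz⟩)
      rw [h1]
      exact hA.1 n f (h (Or.inl rfl)) _

theorem exists_code (A : Allowed) (hA : A.conjBound = ℵ₀)
    (e : (Σ n, L.Functions n) → ℕ) (r : (Σ n, L.Relations n) → ℕ)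
    (U : Set (Σ n, L.Functions n)) (V : Set (Σ n, L.Relations n))
    (φ : Fml L) (h : Ok A φ) (hU : uF φ ⊆ U) (hV : uR φ ⊆ V) :
    ∃ c : Code, ∀ (M : Type) (S : L.Structure M) (S' : Lu.Structure M), Agree e r U V M S S' →
      ∀ (va : ℕ → M) vs vr, Eval φ va vs vr ↔ Eval c.toFml va vs vr := by
  induction φ with
  | @rel n R ts =>
      refine ⟨.rel n (r ⟨n, R⟩) fun i => trT e (ts i), fun M S S' hS va vs vr => ?_⟩
      simp only [Code.toFml, Eval]
      have h1 : (fun i => (ts i).realize va) = fun i => (trT e (ts i)).realize va := by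
        funext i
        exact realize_trT e r U V M S S' hS va (ts i) ((Set.subset_iUnion _ i).trans hU)
      rw [h1]
      exact hS.2 n R (hV rfl) _
  | eq t₁ t₂ =>
      refine ⟨.eq (trT e t₁) (trT e t₂), fun M S S' hS va vs vr => ?_⟩
      simp only [Code.toFml, Eval]
      rw [realize_trT e r U V M S S' hS va t₁ (Set.subset_union_left.trans hU),
        realize_trT e r U V M S S' hS va t₂ (Set.subset_union_right.trans hU)]
  | mem X t =>
      refine ⟨.mem X (trT e t), fun M S S' hS va vs vr => ?_⟩
      simp only [Code.toFml, Eval]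
      rw [realize_trT e r U V M S S' hS va t hU]
  | rmem R t₁ t₂ =>
      refine ⟨.rmem R (trT e t₁) (trT e t₂), fun M S S' hS va vs vr => ?_⟩
      simp only [Code.toFml, Eval]
      rw [realize_trT e r U V M S S' hS va t₁ (Set.subset_union_left.trans hU),
        realize_trT e r U V M S S' hS va t₂ (Set.subset_union_right.trans hU)]
  | not φ ih =>
      obtain ⟨c, hc⟩ := ih h hU hV
      exact ⟨.not c, fun M S S' hS va vs vr => not_congr (hc M S S' hS va vs vr)⟩
  | conj ι f ih =>
      have : Finite ι := Cardinal.lt_aleph0_iff_finite.1 (hA ▸ h.1)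
      choose c hc using fun i => ih i (h.2 i) ((Set.subset_iUnion _ i).trans hU)
        ((Set.subset_iUnion _ i).trans hV)
      obtain ⟨n, ⟨E⟩⟩ := Finite.exists_equiv_fin ι
      refine ⟨.conj n fun i => c (E.symm i), fun M S S' hS va vs vr => ?_⟩
      simp only [Code.toFml, Eval]
      rw [E.symm.forall_congr_left]
      exact forall_congr' fun i => by simpa using hc i M S S' hS va vs vr
  | all x φ ih =>
      obtain ⟨c, hc⟩ := ih h hU hV
      exact ⟨.all x c, fun M S S' hS va vs vr => forall_congr' fun a => hc M S S' hS _ vs vr⟩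
  | qWo x y φ ih =>
      obtain ⟨c, hc⟩ := ih h.2 hU hV
      refine ⟨.qWo x y c, fun M S S' hS va vs vr => ?_⟩
      simp only [Code.toFml, Eval, hc M S S' hS]
  | qC X φ ih =>
      obtain ⟨c, hc⟩ := ih h.2 hU hV
      refine ⟨.qC X c, fun M S S' hS va vs vr => ?_⟩
      simp only [Code.toFml, Eval, hc M S S' hS]
  | qAA X φ ih =>
      obtain ⟨c, hc⟩ := ih h.2 hU hV
      refine ⟨.qAA X c, fun M S S' hS va vs vr => ?_⟩
      simp only [Code.toFml, Eval, hc M S S' hS]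
  | qII R φ ih =>
      obtain ⟨c, hc⟩ := ih h.2 hU hV
      refine ⟨.qII R c, fun M S S' hS va vs vr => ?_⟩
      simp only [Code.toFml, Eval, hc M S S' hS]
  | qCf x y φ ih =>
      obtain ⟨c, hc⟩ := ih h.2 hU hV
      refine ⟨.qCf x y c, fun M S S' hS va vs vr => ?_⟩
      simp only [Code.toFml, Eval, hc M S S' hS]

open Classical in
theorem exists_agree (e : (Σ n, L.Functions n) → ℕ) (r : (Σ n, L.Relations n) → ℕ)
    (U : Set (Σ n, L.Functions n)) (V : Set (Σ n, L.Relations n))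
    (he : Set.InjOn e U) (hr : Set.InjOn r V) (M : Type) [Nonempty M] (S : L.Structure M) :
    ∃ S' : Lu.Structure M, Agree e r U V M S S' := by
  refine ⟨⟨fun {n} k x => if h : ∃ f : L.Functions n, ⟨n, f⟩ ∈ U ∧ e ⟨n, f⟩ = k then
      S.funMap h.choose x else Classical.arbitrary M,
    fun {n} k x => ∃ f : L.Relations n, ⟨n, f⟩ ∈ V ∧ r ⟨n, f⟩ = k ∧ S.RelMap f x⟩, ?_, ?_⟩
  · intro n f hf x
    have h : ∃ g : L.Functions n, ⟨n, g⟩ ∈ U ∧ e ⟨n, g⟩ = e ⟨n, f⟩ := ⟨f, hf, rfl⟩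
    have h2 : h.choose = f := by
      have := he h.choose_spec.1 hf h.choose_spec.2
      simpa using this
    refine Eq.trans ?_ (dif_pos h).symm
    rw [h2]
  · intro n f hf x
    constructor
    · intro h
      exact ⟨f, hf, rfl, h⟩
    · rintro ⟨g, hg, hgf, h⟩
      have := hr hg hf hgf
      have h2 : g = f := by simpa using this
      exact h2 ▸ h

/-- The Hanf value of a code, over nonempty models. -/
noncomputable def codeVal (c : Code) : Cardinal.{0} :=
  sSup {k | ∃ (M : Type) (S : Lu.Structure M), Nonempty M ∧ @Sat Lu M S c.toFml ∧
    k = Order.succ #M}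

theorem bddAbove_hanf (A : Allowed) (hA : A.conjBound = ℵ₀) :
    BddAbove {c | ∃ (L : FirstOrder.Language.{0,0}) (φ : Fml L),
      IsSentence φ ∧ Ok A φ ∧ BddSpec φ ∧ c = hanfVal φ} := by
  obtain ⟨B, hB⟩ := Cardinal.bddAbove_range codeVal
  refine ⟨max 1 B, ?_⟩
  rintro _ ⟨L, φ, -, hok, ⟨κ, hκ⟩, rfl⟩
  obtain ⟨e, he⟩ := Set.countable_iff_exists_injOn.1 (uF_countable A hA φ hok)
  obtain ⟨r, hr⟩ := Set.countable_iff_exists_injOn.1 (uR_countable A hA φ hok)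
  obtain ⟨c, hc⟩ := exists_code A hA e r _ _ φ hok subset_rfl subset_rfl
  refine csSup_le' ?_
  rintro _ ⟨M, S, hS, rfl⟩
  rcases isEmpty_or_nonempty M with hM | hM
  · refine le_max_of_le_left ?_
    rw [Cardinal.mk_eq_zero, Cardinal.succ_zero]
  · refine le_max_of_le_right (le_trans ?_ (hB ⟨c, rfl⟩))
    obtain ⟨S', hS'⟩ := exists_agree e r _ _ he hr M S
    refine le_csSup ⟨κ, ?_⟩ ⟨M, S', hM, fun va vs vr => (hc M S S' hS' va vs vr).1 (hS va vs vr), rfl⟩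
    rintro _ ⟨N, T', -, hT', rfl⟩
    let T : L.Structure N := ⟨fun {n} f x => T'.funMap (show Lu.Functions n from e ⟨n, f⟩) x,
      fun {n} f x => T'.RelMap (show Lu.Relations n from r ⟨n, f⟩) x⟩
    have hT : Agree e r (uF φ) (uR φ) N T T' := ⟨fun _ _ _ _ => rfl, fun _ _ _ _ => Iff.rfl⟩
    exact Order.succ_le_of_lt
      (hκ N T fun va vs vr => (hc N T T' hT va vs vr).2 (hT' va vs vr))

theorem first_part (L : FirstOrder.Language.{0,0}) (φ : Fml L) (hφ : IsSentence φ)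
    (hok : Ok Lcf φ) : ∃ ψ : Fml L, IsSentence ψ ∧ Ok Laa ψ ∧
        ∀ (M : Type) (S : L.Structure M), (@Sat L M S φ ↔ @Sat L M S ψ) := by
  obtain ⟨ψ, h1, h2, h3, h4, h5⟩ := exists_trans φ hok hφ.2.1
  refine ⟨ψ, ⟨Set.subset_eq_empty h1 hφ.1, h2, Set.subset_eq_empty h3 hφ.2.2⟩, h4, fun M S => ?_⟩
  exact forall_congr' fun va => forall_congr' fun vs => forall_congr' fun vr => h5 M S va vs vr

end Helpers

/-- Every sentence of the countable-cofinality-quantifier logic `L_{ω,ω}(Q^{cf}_{ℵ₀})`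
is equivalent (has exactly the same models, in every vocabulary) to a sentence of
stationary logic `L^{aa}_{ω,ω}`; consequently
`h(L_{ω,ω}(Q^{cf}_{ℵ₀})) ≤ h(L^{aa}_{ω,ω})`. -/
theorem cf_sublogic_of_aa :
    (∀ (L : FirstOrder.Language.{0,0}) (φ : Fml L),
      IsSentence φ → Ok Lcf φ →
      ∃ ψ : Fml L, IsSentence ψ ∧ Ok Laa ψ ∧
        ∀ (M : Type) (S : L.Structure M), (@Sat L M S φ ↔ @Sat L M S ψ)) ∧
    hanfNum Lcf ≤ hanfNum Laa := by
  refine ⟨first_part, csSup_le_csSup' (bddAbove_hanf Laa rfl) ?_⟩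
  rintro _ ⟨L, φ, hφ, hok, ⟨κ, hκ⟩, rfl⟩
  obtain ⟨ψ, h1, h2, h3⟩ := first_part L φ hφ hok
  refine ⟨L, ψ, h1, h2, ⟨κ, fun M S h => hκ M S ((h3 M S).2 h)⟩, ?_⟩
  simp only [hanfVal, h3]

end Hanf
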